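/- arXiv:1711.07087 — 3 statements merged into one kernel-verified Lean document; each statement's English description precedes it below -/
import Mathlib

section
/- The lowered Riemann curvature of the pp-metric is given explicitly by R[{Γ}]_{κλμν} = −½ (l_κ ∂_λ − l_λ ∂_κ)(l_μ ∂_ν − l_ν ∂_μ) f, i.e. R[{Γ}]_{κλμν} = −½ ( l_κ l_μ ∂_λ∂_ν f − l_κ l_ν ∂_λ∂_μ f − l_λ l_μ ∂_κ∂_ν f + l_λ l_ν ∂_κ∂_μ f ), for all indices κ, λ, μ, ν. -/
noncomputable section

open scoped BigOperators

/-- Points of spacetime: ℝ⁴ with coordinates x⁰, x¹, x², x³. -/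
abbrev Spacetime := Fin 4 → ℝ

/-- Partial derivative ∂_μ of a scalar function. -/
def pd (μ : Fin 4) (h : Spacetime → ℝ) : Spacetime → ℝ :=
  fun x => fderiv ℝ h x (Pi.single μ 1)

/-- The pp-metric g_{μν}: nonzero components g₀₃ = g₃₀ = 1, g₁₁ = g₂₂ = −1, g₃₃ = f. -/
def ppMetric (f : Spacetime → ℝ) (x : Spacetime) (μ ν : Fin 4) : ℝ :=
  if μ = 0 ∧ ν = 3 then 1 else if μ = 3 ∧ ν = 0 then 1
  else if μ = 1 ∧ ν = 1 then -1 else if μ = 2 ∧ ν = 2 then -1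
  else if μ = 3 ∧ ν = 3 then f x else 0

/-- The pointwise inverse metric g^{μν}: g⁰⁰ = −f, g⁰³ = g³⁰ = 1, g¹¹ = g²² = −1. -/
def ppMetricInv (f : Spacetime → ℝ) (x : Spacetime) (μ ν : Fin 4) : ℝ :=
  if μ = 0 ∧ ν = 0 then -(f x) else if μ = 0 ∧ ν = 3 then 1
  else if μ = 3 ∧ ν = 0 then 1
  else if μ = 1 ∧ ν = 1 then -1 else if μ = 2 ∧ ν = 2 then -1 else 0

/-- Christoffel symbols {Γ}^λ_{μν} = ½ g^{λκ}(∂_μ g_{κν} + ∂_ν g_{κμ} − ∂_κ g_{μν}). -/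
def christoffel (f : Spacetime → ℝ) (x : Spacetime) (l μ ν : Fin 4) : ℝ :=
  (1/2) * ∑ κ, ppMetricInv f x l κ *
    (pd μ (fun y => ppMetric f y κ ν) x + pd ν (fun y => ppMetric f y κ μ) x
      - pd κ (fun y => ppMetric f y μ ν) x)

/-- Totally antisymmetric symbol ε with ε₀₁₂₃ = 1. -/
def eps (a b c d : Fin 4) : ℝ :=
  ((((b:ℕ):ℝ) - ((a:ℕ):ℝ)) * (((c:ℕ):ℝ) - ((a:ℕ):ℝ)) * (((d:ℕ):ℝ) - ((a:ℕ):ℝ)) *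
    (((c:ℕ):ℝ) - ((b:ℕ):ℝ)) * (((d:ℕ):ℝ) - ((b:ℕ):ℝ)) * (((d:ℕ):ℝ) - ((c:ℕ):ℝ))) / 12

/-- Purely axial torsion T_{κμν} = k(x³) ε_{0κμν}. -/
def torsion (k : ℝ → ℝ) (x : Spacetime) (κ μ ν : Fin 4) : ℝ :=
  k (x 3) * eps 0 κ μ ν

/-- Contorsion K^κ_{μν} = ½ g^{κρ} T_{ρμν}. -/
def contorsion (f : Spacetime → ℝ) (k : ℝ → ℝ) (x : Spacetime) (κ μ ν : Fin 4) : ℝ :=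
  (1/2) * ∑ ρ, ppMetricInv f x κ ρ * torsion k x ρ μ ν

/-- The full connection Γ^λ_{μν} = {Γ}^λ_{μν} + K^λ_{μν}. -/
def fullConn (f : Spacetime → ℝ) (k : ℝ → ℝ) (x : Spacetime) (κ μ ν : Fin 4) : ℝ :=
  christoffel f x κ μ ν + contorsion f k x κ μ ν

/-- Curvature R[A]^κ_{λμν} of connection coefficients A^κ_{μν}. -/
def curv (A : Spacetime → Fin 4 → Fin 4 → Fin 4 → ℝ) (x : Spacetime)
    (κ l μ ν : Fin 4) : ℝ :=
  pd μ (fun y => A y κ ν l) x - pd ν (fun y => A y κ μ l) x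
    + ∑ η, (A x κ μ η * A x η ν l - A x κ ν η * A x η μ l)

/-- The parallel null vector field l^μ = (1,0,0,0). -/
def lUp : Fin 4 → ℝ := fun μ => if μ = 0 then 1 else 0

/-- The lowered vector l_μ = g_{μν} l^ν = (0,0,0,1). -/
def lCov : Fin 4 → ℝ := fun μ => if μ = 3 then 1 else 0

theorem lCov_zero : lCov 0 = 0 := by simp [lCov]

theorem lCov_one : lCov 1 = 0 := by simp [lCov]

theorem lCov_two : lCov 2 = 0 := by simp [lCov]

theorem lCov_three : lCov 3 = 1 := by simp [lCov]

theorem pd_ppMetric (f : Spacetime → ℝ) (x : Spacetime) (σ μ ν : Fin 4) :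
    pd σ (fun y => ppMetric f y μ ν) x = lCov μ * lCov ν * pd σ f x := by
  fin_cases μ <;> fin_cases ν <;> simp [pd, ppMetric, lCov]

/-- Closed form of the Christoffel symbols of the pp-metric. -/
theorem christoffel_eq (f : Spacetime → ℝ) (h0 : ∀ x, pd 0 f x = 0) (x : Spacetime)
    (l μ ν : Fin 4) :
    christoffel f x l μ ν =
      1 / 2 * lUp l * lCov ν * pd μ f x + 1 / 2 * lUp l * lCov μ * pd ν f x
        + (if l = 3 then 0 else 1 / 2) * lCov μ * lCov ν * pd l f x
        - 1 / 2 * lUp l * lCov μ * lCov ν * pd 3 f x := by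
  simp only [christoffel, pd_ppMetric, Fin.sum_univ_four]
  fin_cases l <;> 
    simp [ppMetricInv, lUp, lCov_zero, lCov_one, lCov_two, lCov_three, h0] <;> ring

theorem differentiable_pd {f : Spacetime → ℝ} (hf : ContDiff ℝ (⊤ : ℕ∞) f) (μ : Fin 4) :
    Differentiable ℝ (pd μ f) := by
  have h : ContDiff ℝ 1 (fderiv ℝ f) := hf.fderiv_right (by norm_cast)
  exact (h.differentiable one_ne_zero).clm_apply (differentiable_const _)

theorem pd_comm {f : Spacetime → ℝ} (hf : ContDiff ℝ (⊤ : ℕ∞) f) (μ ν : Fin 4)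
    (x : Spacetime) : pd μ (pd ν f) x = pd ν (pd μ f) x := by
  have h : Differentiable ℝ (fderiv ℝ f) :=
    (hf.fderiv_right (m := 1) (by norm_cast)).differentiable one_ne_zero
  have key (α β : Fin 4) :
      pd α (pd β f) x = fderiv ℝ (fderiv ℝ f) x (Pi.single α 1) (Pi.single β 1) := by
    change fderiv ℝ (fun y => fderiv ℝ f y (Pi.single β 1)) x (Pi.single α 1) = _
    rw [fderiv_clm_apply (h x) (differentiableAt_const _)]
    simp
  have hsymm : IsSymmSndFDerivAt ℝ f x :=
    hf.contDiffAt.isSymmSndFDerivAt (by simp; norm_cast)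
  rw [key, key, hsymm.eq]

theorem pd_christoffel {f : Spacetime → ℝ} (hf : ContDiff ℝ (⊤ : ℕ∞) f)
    (h0 : ∀ x, pd 0 f x = 0) (x : Spacetime) (σ l μ ν : Fin 4) :
    pd σ (fun y => christoffel f y l μ ν) x =
      1 / 2 * lUp l * lCov ν * pd σ (pd μ f) x + 1 / 2 * lUp l * lCov μ * pd σ (pd ν f) x
        + (if l = 3 then 0 else 1 / 2) * lCov μ * lCov ν * pd σ (pd l f) x
        - 1 / 2 * lUp l * lCov μ * lCov ν * pd σ (pd 3 f) x := by
  have h (α : Fin 4) (c : ℝ) :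
      HasFDerivAt (fun y => c * pd α f y) (c • fderiv ℝ (pd α f) x) x :=
    ((differentiable_pd hf α) x).hasFDerivAt.const_mul c
  have hsum := (((h μ (1 / 2 * lUp l * lCov ν)).add (h ν (1 / 2 * lUp l * lCov μ))).add
    (h l ((if l = 3 then 0 else 1 / 2) * lCov μ * lCov ν))).sub
    (h 3 (1 / 2 * lUp l * lCov μ * lCov ν))
  rw [funext fun y => christoffel_eq f h0 y l μ ν]
  exact congrArg (fun L => L (Pi.single σ 1)) hsum.fderiv

/-- the lowered Riemann curvature of the pp-metric is
R_{κλμν} = −½ (l_κ ∂_λ − l_λ ∂_κ)(l_μ ∂_ν − l_ν ∂_μ) f. -/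
theorem pp_wave_riemann_curvature_formula
    (f : Spacetime → ℝ) (hf : ContDiff ℝ (⊤ : ℕ∞) f) (h0 : ∀ x, pd 0 f x = 0) :
    ∀ (x : Spacetime) (κ lam μ ν : Fin 4),
      (∑ ρ, ppMetric f x κ ρ * curv (christoffel f) x ρ lam μ ν) =
        -(1/2) * (lCov κ * lCov μ * pd lam (pd ν f) x
          - lCov κ * lCov ν * pd lam (pd μ f) x
          - lCov lam * lCov μ * pd κ (pd ν f) x
          + lCov lam * lCov ν * pd κ (pd μ f) x) := by
  intro x κ lam μ ν
  have hz (α : Fin 4) : pd α (pd 0 f) x = 0 := by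
    rw [show pd 0 f = fun _ => 0 from funext h0]
    simp [pd]
  simp only [curv, pd_christoffel hf h0]
  simp only [christoffel_eq f h0, Fin.sum_univ_four]
  rw [pd_comm hf lam ν, pd_comm hf lam μ, pd_comm hf κ ν, pd_comm hf κ μ, pd_comm hf ν μ]
  fin_cases κ <;>
    simp [ppMetric, lUp, lCov_zero, lCov_one, lCov_two, lCov_three, h0, hz] <;> ring
end
end

section
/- The torsion T_{κμν} = k(x³) ε_{0κμν} is purely axial: it is totally antisymmetric in all three indices; its trace vector v_ν = (1/3) g^{λκ} T_{κλν} vanishes identically; and its axial vector w_ν = (1/6) √|det g| T^{κλμ} ε_{κλμν}, where T^{κλμ} = g^{κα} g^{λβ} g^{μγ} T_{αβγ} and det g = −1, equals k(x³) l_ν. -/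
noncomputable section

open scoped BigOperators

theorem eps_swap_two_three (a b c d : Fin 4) : eps a b c d = -eps a c b d := by
  simp only [eps]
  ring

theorem eps_swap_three_four (a b c d : Fin 4) : eps a b c d = -eps a b d c := by
  simp only [eps]
  ring

theorem det_ppMetric (f : Spacetime → ℝ) (x : Spacetime) :
    (Matrix.of (ppMetric f x)).det = -1 := by
  have h : Matrix.of (ppMetric f x) = !![0, 0, 0, 1; 0, -1, 0, 0; 0, 0, -1, 0; 1, 0, 0, f x] := by
    ext i j
    fin_cases i <;> fin_cases j <;> simp [ppMetric]
  rw [h]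
  simp [Matrix.det_succ_row_zero, Fin.sum_univ_succ, Fin.succAbove]
  norm_num

theorem sum_ppMetricInv_mul_torsion (f : Spacetime → ℝ) (k : ℝ → ℝ) (x : Spacetime)
    (κ b c : Fin 4) :
    ∑ a, ppMetricInv f x κ a * torsion k x a b c =
      k (x 3) * (if κ = 0 then eps 0 3 b c else if κ = 3 then 0 else -eps 0 κ b c) := by
  fin_cases κ <;> simp [Fin.sum_univ_four, ppMetricInv, torsion, eps]

/-- Raising all three indices of the torsion gives `k(x³) ε_{κλμ3}`. -/
theorem raised_torsion (f : Spacetime → ℝ) (k : ℝ → ℝ) (x : Spacetime) (κ lam μ : Fin 4) :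
    ∑ a, ∑ b, ∑ c, ppMetricInv f x κ a * ppMetricInv f x lam b *
      ppMetricInv f x μ c * torsion k x a b c = k (x 3) * eps κ lam μ 3 := by
  have h : ∑ a, ∑ b, ∑ c, ppMetricInv f x κ a * ppMetricInv f x lam b *
      ppMetricInv f x μ c * torsion k x a b c =
      ∑ b, ∑ c, ppMetricInv f x lam b * ppMetricInv f x μ c *
        ∑ a, ppMetricInv f x κ a * torsion k x a b c := by
    simp only [Finset.mul_sum]
    rw [Finset.sum_comm]
    refine Finset.sum_congr rfl fun b _ => ?_
    rw [Finset.sum_comm]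
    refine Finset.sum_congr rfl fun c _ => Finset.sum_congr rfl fun a _ => ?_
    ring
  rw [h]
  simp only [sum_ppMetricInv_mul_torsion]
  fin_cases κ <;> fin_cases lam <;> fin_cases μ <;>
    simp [Fin.sum_univ_four, ppMetricInv, eps] <;> norm_num

theorem sum_eps_mul_eps (ν : Fin 4) :
    ∑ κ, ∑ lam, ∑ μ, eps κ lam μ 3 * eps κ lam μ ν = 6 * lCov ν := by
  fin_cases ν <;> simp [Fin.sum_univ_four, eps, lCov]
  norm_num

/-- the torsion T_{κμν} = k(x³) ε_{0κμν} is purely axial: totally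
antisymmetric, with vanishing trace vector v and axial vector w_ν = k(x³) l_ν. -/
theorem torsion_purely_axial
    (f : Spacetime → ℝ) (hf : ContDiff ℝ (⊤ : ℕ∞) f) (h0 : ∀ x, pd 0 f x = 0)
    (k : ℝ → ℝ) (hk : ContDiff ℝ (⊤ : ℕ∞) k) :
    (∀ (x : Spacetime) (κ μ ν : Fin 4),
      torsion k x κ μ ν = - torsion k x μ κ ν ∧
      torsion k x κ μ ν = - torsion k x κ ν μ) ∧
    (∀ (x : Spacetime) (ν : Fin 4),
      (1/3) * ∑ lam, ∑ κ, ppMetricInv f x lam κ * torsion k x κ lam ν = 0) ∧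
    (∀ (x : Spacetime) (ν : Fin 4),
      (1/6) * Real.sqrt |(Matrix.of (ppMetric f x)).det| *
        ∑ κ, ∑ lam, ∑ μ,
          (∑ a, ∑ b, ∑ c, ppMetricInv f x κ a * ppMetricInv f x lam b *
            ppMetricInv f x μ c * torsion k x a b c) * eps κ lam μ ν
        = k (x 3) * lCov ν) := by
  refine ⟨fun x κ μ ν => ⟨?_, ?_⟩, fun x ν => ?_, fun x ν => ?_⟩
  · rw [torsion, torsion, eps_swap_two_three, mul_neg]
  · rw [torsion, torsion, eps_swap_three_four, mul_neg]
  · simp only [sum_ppMetricInv_mul_torsion]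
    simp [eps]
  · simp only [det_ppMetric, raised_torsion]
    simp only [mul_assoc, ← Finset.mul_sum, sum_eps_mul_eps, abs_neg, abs_one, Real.sqrt_one]
    ring
end
end

section
/- The torsion-generated curvature of a generalised pp-wave with purely axial torsion satisfies, for all κ, λ, μ, ν: g_{κρ} R[K]^ρ_{λμν} = ¼ k(x³)² Re( F_{κλ} F̄_{μν} ) − ½ k′(x³) Im( F_{κλ} F̄_{μν} ), where R[K]^ρ_{λμν} = ∂_μ K^ρ_{νλ} − ∂_ν K^ρ_{μλ} + K^ρ_{μη} K^η_{νλ} − K^ρ_{νη} K^η_{μλ} and k′ is the derivative of k. -/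
noncomputable section

open scoped BigOperators

/-- The complex vector m_μ = (0,−1,i,0). -/
def mCov : Fin 4 → ℂ := ![0, -1, Complex.I, 0]

/-- l_μ regarded as a complex vector. -/
def lCovC : Fin 4 → ℂ := fun μ => if μ = 3 then 1 else 0

/-- The bivector F_{κλ} = (l ∧ m)_{κλ} = l_κ m_λ − m_κ l_λ. -/
def Fbiv (κ l : Fin 4) : ℂ := lCovC κ * mCov l - mCov κ * lCovC l

/-- The integer-valued alternating symbol. -/
def epsInt (a b c d : Fin 4) : ℤ :=
  ((b : ℕ) - (a : ℕ)) * ((c : ℕ) - (a : ℕ)) * ((d : ℕ) - (a : ℕ)) *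
    ((c : ℕ) - (b : ℕ)) * ((d : ℕ) - (b : ℕ)) * ((d : ℕ) - (c : ℕ)) / 12

theorem eps_eq_intCast (a b c d : Fin 4) : eps a b c d = epsInt a b c d := by
  have h : ∀ a b c d : Fin 4,
      (((b : ℕ) - (a : ℕ)) * ((c : ℕ) - (a : ℕ)) * ((d : ℕ) - (a : ℕ)) *
        ((c : ℕ) - (b : ℕ)) * ((d : ℕ) - (b : ℕ)) * ((d : ℕ) - (c : ℕ)) : ℤ) =
        epsInt a b c d * 12 := by
    decide +kernel
  rw [eps, div_eq_iff (by norm_num)]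
  exact_mod_cast h a b c d

/-- The integers `c^κ_{μν}` with `contorsion = k(x³) c^κ_{μν} / 2`; the profile `f` does not
enter. -/
def axialCoeff (κ μ ν : Fin 4) : ℤ :=
  ![epsInt 0 3 μ ν, -epsInt 0 1 μ ν, -epsInt 0 2 μ ν, 0] κ

theorem contorsion_eq (f : Spacetime → ℝ) (k : ℝ → ℝ) (x : Spacetime) (κ μ ν : Fin 4) :
    contorsion f k x κ μ ν = k (x 3) * (axialCoeff κ μ ν / 2) := by
  have h : epsInt 0 0 μ ν = 0 := by simp [epsInt]
  fin_cases κ <;>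
    simp [contorsion, axialCoeff, Fin.sum_univ_four, ppMetricInv, torsion, eps_eq_intCast, h] <;>
    ring

theorem pd_comp_coord_mul_const {k : ℝ → ℝ} {x : Spacetime} {i : Fin 4}
    (hk : DifferentiableAt ℝ k (x i)) (μ : Fin 4) (c : ℝ) :
    pd μ (fun y => k (y i) * c) x = if μ = i then deriv k (x i) * c else 0 := by
  have h : HasFDerivAt (fun y : Spacetime => k (y i) * c) _ x :=
    (hk.hasDerivAt.comp_hasFDerivAt x
      (hasFDerivAt_apply (𝕜 := ℝ) (F' := fun _ : Fin 4 => ℝ) i x)).mul_const c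
  rw [pd, h.fderiv]
  by_cases hμ : μ = i
  · subst hμ
    simp [mul_comm]
  · simp [hμ]

/-- The coefficient of `k′/2` in the curvature of the contorsion. -/
def derivCoeff (κ l μ ν : Fin 4) : ℤ :=
  (if μ = 3 then axialCoeff κ ν l else 0) - (if ν = 3 then axialCoeff κ μ l else 0)

/-- The coefficient of `k²/4` in the curvature of the contorsion. -/
def sqCoeff (κ l μ ν : Fin 4) : ℤ :=
  ∑ η, (axialCoeff κ μ η * axialCoeff η ν l - axialCoeff κ ν η * axialCoeff η μ l)

theorem curv_contorsion (f : Spacetime → ℝ) {k : ℝ → ℝ} (hk : Differentiable ℝ k)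
    (x : Spacetime) (κ l μ ν : Fin 4) :
    curv (contorsion f k) x κ l μ ν =
      1 / 4 * k (x 3) ^ 2 * sqCoeff κ l μ ν + 1 / 2 * deriv k (x 3) * derivCoeff κ l μ ν := by
  simp only [curv, contorsion_eq, pd_comp_coord_mul_const (hk _), sqCoeff, derivCoeff]
  rw [add_comm]
  push_cast
  rw [Finset.mul_sum]
  congr 1
  · exact Finset.sum_congr rfl fun η _ => by ring
  · split_ifs <;> ring

/-- Lowering the first index, on vectors `v` with `v³ = 0`. -/
theorem sum_ppMetric_mul (f : Spacetime → ℝ) (x : Spacetime) (κ : Fin 4) (v : Fin 4 → ℝ)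
    (hv : v 3 = 0) : ∑ ρ, ppMetric f x κ ρ * v ρ = ![0, -v 1, -v 2, v 0] κ := by
  fin_cases κ <;> simp [Fin.sum_univ_four, ppMetric, hv]

/-- The bivector `l ∧ v` for an integer covector `v`. -/
def lWedge (v : Fin 4 → ℤ) (κ l : Fin 4) : ℤ :=
  (if κ = 3 then v l else 0) - (if l = 3 then v κ else 0)

theorem Fbiv_re (κ l : Fin 4) : (Fbiv κ l).re = lWedge ![0, -1, 0, 0] κ l := by
  fin_cases κ <;> fin_cases l <;> simp [Fbiv, lCovC, mCov, lWedge]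

theorem Fbiv_im (κ l : Fin 4) : (Fbiv κ l).im = lWedge ![0, 0, 1, 0] κ l := by
  fin_cases κ <;> fin_cases l <;> simp [Fbiv, lCovC, mCov, lWedge]

theorem lower_sqCoeff : ∀ κ l μ ν : Fin 4,
    ![0, -sqCoeff 1 l μ ν, -sqCoeff 2 l μ ν, sqCoeff 0 l μ ν] κ =
      lWedge ![0, -1, 0, 0] κ l * lWedge ![0, -1, 0, 0] μ ν
        + lWedge ![0, 0, 1, 0] κ l * lWedge ![0, 0, 1, 0] μ ν := by
  decide +kernel

theorem lower_derivCoeff : ∀ κ l μ ν : Fin 4,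
    ![0, -derivCoeff 1 l μ ν, -derivCoeff 2 l μ ν, derivCoeff 0 l μ ν] κ =
      lWedge ![0, -1, 0, 0] κ l * lWedge ![0, 0, 1, 0] μ ν
        - lWedge ![0, 0, 1, 0] κ l * lWedge ![0, -1, 0, 0] μ ν := by
  decide +kernel

/-- the lowered torsion-generated curvature equals
¼ k² Re(F_{κλ} F̄_{μν}) − ½ k′ Im(F_{κλ} F̄_{μν}). -/
theorem torsion_generated_curvature_formula
    (f : Spacetime → ℝ) (hf : ContDiff ℝ (⊤ : ℕ∞) f) (h0 : ∀ x, pd 0 f x = 0)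
    (k : ℝ → ℝ) (hk : ContDiff ℝ (⊤ : ℕ∞) k) :
    ∀ (x : Spacetime) (κ lam μ ν : Fin 4),
      (∑ ρ, ppMetric f x κ ρ * curv (contorsion f k) x ρ lam μ ν) =
        (1/4) * (k (x 3))^2 * (Fbiv κ lam * (starRingEnd ℂ) (Fbiv μ ν)).re
          - (1/2) * deriv k (x 3) * (Fbiv κ lam * (starRingEnd ℂ) (Fbiv μ ν)).im := by
  intro x κ lam μ ν
  have hk' : Differentiable ℝ k := hk.differentiable (by simp)
  have h3 : curv (contorsion f k) x 3 lam μ ν = 0 := by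
    simp [curv_contorsion f hk', sqCoeff, derivCoeff, axialCoeff]
  have hre : (Fbiv κ lam * (starRingEnd ℂ) (Fbiv μ ν)).re =
      (![0, -sqCoeff 1 lam μ ν, -sqCoeff 2 lam μ ν, sqCoeff 0 lam μ ν] κ : ℤ) := by
    rw [lower_sqCoeff]
    simp [Fbiv_re, Fbiv_im]
  have him : (Fbiv κ lam * (starRingEnd ℂ) (Fbiv μ ν)).im =
      -(![0, -derivCoeff 1 lam μ ν, -derivCoeff 2 lam μ ν, derivCoeff 0 lam μ ν] κ : ℤ) := by
    rw [lower_derivCoeff]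
    simp [Fbiv_re, Fbiv_im]
    ring
  rw [sum_ppMetric_mul f x κ _ h3, hre, him]
  simp only [curv_contorsion f hk']
  fin_cases κ <;> simp <;> ring
end
end
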